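/- Let ⟨μ,d⟩ be a generating tuple with degree-monotone weights and let H ∈ ℛℋ(μ,d) be a directed Huffman tree with star sequence S₁,…,S_q. If v ∈ L(S_i), v′ ∈ L(S_j), and i < j, then f_H(v) ≤ f_H(v′). -/

import Mathlib

open scoped Classical
noncomputable section

/-- A directed tree on a finite vertex set `V`: each vertex has an outbound arc to its
`parent`, the `root` is a fixed point of `parent` (i.e. has no genuine outbound arc), and
every vertex reaches the root by iterating `parent`. -/
structure DirTree (V : Type) [Fintype V] [DecidableEq V] where
  root : V
  parent : V → V
  parent_root : parent root = root
  reaches : ∀ v, ∃ n, parent^[n] v = root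

variable {V : Type} [Fintype V] [DecidableEq V]

namespace DirTree

/-- `u` belongs to the subordinate group of `v`: there is a directed path from `u` to `v`. -/
def Desc (T : DirTree V) (u v : V) : Prop := ∃ n, T.parent^[n] u = v

/-- The set of vertices with an arc to `v`. -/
def children (T : DirTree V) (v : V) : Finset V :=
  Finset.univ.filter fun u => T.parent u = v ∧ u ≠ v

/-- Weight `f_T(v)` of the subordinate group of `v`. -/
def f (T : DirTree V) (μ : V → ℝ) (v : V) : ℝ :=
  ∑ u ∈ Finset.univ.filter (fun u => T.Desc u v), μ u

/-- Degree of `v` in the underlying undirected tree. -/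
def deg (T : DirTree V) (v : V) : ℕ :=
  (T.children v).card + (if v = T.root then 0 else 1)

/-- The underlying undirected tree. -/
def toGraph (T : DirTree V) : SimpleGraph V :=
  SimpleGraph.fromRel fun u v => T.parent u = v ∧ u ≠ v

/-- The vector (as a multiset, i.e. up to ascending rearrangement) of subordinate
groups' weights of internal non-root vertices. -/
def fvec (T : DirTree V) (μ : V → ℝ) : Multiset ℝ :=
  (Finset.univ.filter fun m => 1 < T.deg m ∧ m ≠ T.root).val.map (T.f μ)

end DirTree

/-- Degree of a vertex in a simple graph. -/
def gdeg (G : SimpleGraph V) (v : V) : ℕ :=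
  (Finset.univ.filter fun u => G.Adj v u).card

/-- `⟨μ, d⟩` is a generating tuple: nonnegative weights, degrees at least 1 summing to
`2(|V|-1)`, at least two pendent and at least one internal vertex. -/
structure IsGenTuple (μ : V → ℝ) (d : V → ℕ) : Prop where
  nonneg : ∀ v, 0 ≤ μ v
  deg_pos : ∀ v, 1 ≤ d v
  sum_deg : ∑ v, d v = 2 * (Fintype.card V - 1)
  two_le_pendent : 2 ≤ (Finset.univ.filter fun v => d v = 1).card
  one_le_internal : 1 ≤ (Finset.univ.filter fun v => 1 < d v).card

/-- Weights are degree-monotone in `⟨μ, d⟩`. -/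
def DegMonotone (μ : V → ℝ) (d : V → ℕ) : Prop :=
  (∀ m m', 1 < d m → 1 < d m' → d m < d m' → μ m ≤ μ m') ∧
  ∀ v, d v = 1 → 0 < μ v

/-- `T ∈ ℛ(μ,d)`: directed tree with internal root whose (undirected) degrees match `d`. -/
def memR (T : DirTree V) (d : V → ℕ) : Prop :=
  1 < d T.root ∧ ∀ v, T.deg v = d v

/-- `G ∈ 𝒯(μ,d)`: `G` is a tree whose degrees match `d`. -/
def memT (G : SimpleGraph V) (d : V → ℕ) : Prop :=
  G.IsTree ∧ ∀ v, gdeg G v = d v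

/-- Vertex-weighted Wiener index. -/
def VWWI (μ : V → ℝ) (G : SimpleGraph V) : ℝ :=
  (1 / 2) * ∑ u, ∑ v, μ u * μ v * (G.dist u v : ℝ)

/-- `S = (m, L)` is a minimal star for the state `(U, μ, d)`: the center `m` is an
internal vertex of `U` of least degree among internal vertices of least weight, and the
`d m - 1` leaves `L` are pendent vertices of `U` of least weights. -/
def IsMinimalStar (U : Finset V) (μ : V → ℝ) (d : V → ℕ) (m : V) (L : Finset V) : Prop :=
  m ∈ U ∧ 1 < d m ∧ L ⊆ U ∧ m ∉ L ∧ L.card = d m - 1 ∧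
  (∀ v ∈ L, d v = 1) ∧
  (∀ m' ∈ U, 1 < d m' → μ m ≤ μ m') ∧
  (∀ m' ∈ U, 1 < d m' → μ m' = μ m → d m ≤ d m') ∧
  ∀ u ∈ L, ∀ w ∈ U, d w = 1 → w ∉ L → μ u ≤ μ w

/-- Centers used before step `i` (0-indexed). -/
def usedCenters {q : ℕ} (c : Fin q → V) (i : ℕ) : Finset V :=
  (Finset.univ.filter fun j : Fin q => (j : ℕ) < i).image c

/-- Vertex set `V_{i+1}` of the state of the Huffman algorithm before (0-indexed) step `i`,
for the candidate Huffman tree `T` with star centers `c`. -/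
def stateV (T : DirTree V) {q : ℕ} (c : Fin q → V) (i : ℕ) : Finset V :=
  Finset.univ \ (Finset.univ.filter fun j : Fin q => (j : ℕ) < i).biUnion fun j => T.children (c j)

/-- Weight function `μ^{i+1}` of the state before (0-indexed) step `i`. -/
def stateMu (T : DirTree V) (μ : V → ℝ) {q : ℕ} (c : Fin q → V) (i : ℕ) : V → ℝ :=
  fun v => if v ∈ usedCenters c i then T.f μ v else μ v

/-- Degree function `d^{i+1}` of the state before (0-indexed) step `i`. -/
def stateD (d : V → ℕ) {q : ℕ} (c : Fin q → V) (i : ℕ) : V → ℕ :=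
  fun v => if v ∈ usedCenters c i then 1 else d v

/-- `T` is a directed Huffman tree for `⟨μ, d⟩` whose star sequence has centers
`c 0, …, c (q-1)` (so `S_i` has leaf set `children (c i)`): the centers enumerate the
internal vertices, the root is the last center, and at each of the first `q - 1` steps
the corresponding star is a minimal star of the current state. -/
def IsHuffmanSeq (μ : V → ℝ) (d : V → ℕ) (T : DirTree V) {q : ℕ} (c : Fin q → V) : Prop :=
  (∀ v, T.deg v = d v) ∧
  Function.Injective c ∧
  (∀ v, 1 < d v ↔ ∃ j, c j = v) ∧
  (∀ hq : 0 < q, T.root = c ⟨q - 1, Nat.sub_lt hq Nat.one_pos⟩) ∧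
  ∀ i : Fin q, (i : ℕ) < q - 1 →
    IsMinimalStar (stateV T c (i : ℕ)) (stateMu T μ c (i : ℕ)) (stateD d c (i : ℕ))
      (c i) (T.children (c i))

/-- `T ∈ ℛℋ(μ,d)`: `T` is a directed Huffman tree for `⟨μ, d⟩`. -/
def IsHuffmanDir (μ : V → ℝ) (d : V → ℕ) (T : DirTree V) : Prop :=
  ∃ (q : ℕ) (c : Fin q → V), IsHuffmanSeq μ d T c

/-- Sum of the `k` smallest components of a multiset of reals. -/
def ascSum (s : Multiset ℝ) (k : ℕ) : ℝ := ((s.sort (· ≤ ·)).take k).sum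

/-- `x` weakly majorizes `y` (`y ⪯^w x`). -/
def WMaj (x y : Multiset ℝ) : Prop :=
  Multiset.card x = Multiset.card y ∧ ∀ k, ascSum x k ≤ ascSum y k

/-- `x` strictly weakly majorizes `y` (`y ≺^w x`). -/
def SWMaj (x y : Multiset ℝ) : Prop := WMaj x y ∧ x ≠ y

namespace DirTree

theorem ne_root_of_mem_children (T : DirTree V) {u p : V} (hu : u ∈ T.children p) :
    u ≠ T.root := by
  simp only [children, Finset.mem_filter, Finset.mem_univ, true_and] at hu
  rintro rfl
  exact hu.2 (T.parent_root.symm.trans hu.1)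

theorem parent_eq_of_mem_children (T : DirTree V) {u p : V} (hu : u ∈ T.children p) :
    T.parent u = p := by
  simp only [children, Finset.mem_filter, Finset.mem_univ, true_and] at hu
  exact hu.1

theorem desc_of_mem_children (T : DirTree V) {u p : V} (hu : u ∈ T.children p) :
    T.Desc u p :=
  ⟨1, T.parent_eq_of_mem_children hu⟩

theorem Desc.trans {T : DirTree V} {u v w : V} (huv : T.Desc u v) (hvw : T.Desc v w) :
    T.Desc u w := by
  obtain ⟨m, rfl⟩ := huv
  obtain ⟨n, rfl⟩ := hvw
  exact ⟨n + m, Function.iterate_add_apply _ _ _ _⟩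

/-- The subordinate group's weight increases along directed paths. -/
theorem f_le_of_desc (T : DirTree V) {μ : V → ℝ} (hμ : ∀ v, 0 ≤ μ v) {u v : V}
    (h : T.Desc u v) : T.f μ u ≤ T.f μ v := by
  refine Finset.sum_le_sum_of_subset_of_nonneg (fun w hw => ?_) fun w _ _ => hμ w
  simp only [Finset.mem_filter, Finset.mem_univ, true_and] at hw ⊢
  exact hw.trans h

theorem f_eq_of_children_eq_empty (T : DirTree V) (μ : V → ℝ) {v : V}
    (h : T.children v = ∅) : T.f μ v = μ v := by
  have key : ∀ u, T.Desc u v ↔ u = v := by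
    refine fun u => ⟨?_, fun hu => ⟨0, hu⟩⟩
    rintro ⟨n, hn⟩
    induction n with
    | zero => exact hn
    | succ n ih =>
      rw [Function.iterate_succ_apply'] at hn
      by_contra! hne
      have hmem : T.parent^[n] u ∈ T.children v := by
        simp only [children, Finset.mem_filter, Finset.mem_univ, true_and]
        exact ⟨hn, fun h' => hne (ih h')⟩
      simp [h] at hmem
  rw [f, Finset.filter_congr fun u _ => key u, Finset.sum_filter]
  simp

theorem f_eq_of_deg_eq_one (T : DirTree V) (μ : V → ℝ) {v : V} (hv : v ≠ T.root)
    (h : T.deg v = 1) : T.f μ v = μ v := by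
  refine T.f_eq_of_children_eq_empty μ (Finset.card_eq_zero.mp ?_)
  simpa [deg, hv] using h

theorem children_nonempty_of_one_lt_deg (T : DirTree V) {v : V} (h : 1 < T.deg v) :
    (T.children v).Nonempty := by
  rw [← Finset.card_pos]
  unfold deg at h
  split_ifs at h <;> omega

end DirTree

theorem mem_usedCenters {α : Type} [DecidableEq α] {q : ℕ} {c : Fin q → α} {i : ℕ} {v : α} :
    v ∈ usedCenters c i ↔ ∃ k : Fin q, (k : ℕ) < i ∧ c k = v := by
  simp [usedCenters]

theorem mem_stateV_of_mem_children {T : DirTree V} {q : ℕ} {c : Fin q → V}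
    (hc : Function.Injective c) {i : ℕ} {j : Fin q} (hij : i ≤ j) {v : V}
    (hv : v ∈ T.children (c j)) : v ∈ stateV T c i := by
  simp only [stateV, Finset.mem_sdiff, Finset.mem_univ, true_and, Finset.mem_biUnion,
    Finset.mem_filter, not_exists, not_and]
  intro k hk hvk
  have : k = j := hc ((T.parent_eq_of_mem_children hvk).symm.trans
    (T.parent_eq_of_mem_children hv))
  subst this
  omega

namespace IsHuffmanSeq

variable {μ : V → ℝ} {d : V → ℕ} {T : DirTree V} {q : ℕ} {c : Fin q → V}

/-- Pendent vertices of a state carry the weight of their subordinate group. -/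
theorem stateMu_eq_f (h : IsHuffmanSeq μ d T c) {i : ℕ} {v : V} (hv : v ≠ T.root)
    (hd : stateD d c i v = 1) : stateMu T μ c i v = T.f μ v := by
  unfold stateMu
  unfold stateD at hd
  split_ifs at hd ⊢
  · rfl
  · exact (T.f_eq_of_deg_eq_one μ hv ((h.1 v).trans hd)).symm

/-- A center is merged into a star only after its own star has been built. -/
theorem lt_of_mem_children (h : IsHuffmanSeq μ d T c) {k j : Fin q}
    (hk : c k ∈ T.children (c j)) : k < j := by
  obtain ⟨-, hinj, hint, hroot, hstar⟩ := h
  by_cases hj : (j : ℕ) < q - 1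
  · obtain ⟨-, -, -, -, -, hone, -⟩ := hstar j hj
    have hd := hone _ hk
    unfold stateD at hd
    split_ifs at hd with hu
    · obtain ⟨l, hl, hlk⟩ := mem_usedCenters.mp hu
      rw [← hinj hlk]
      exact hl
    · have := (hint (c k)).mpr ⟨k, rfl⟩
      omega
  · have hne : (k : ℕ) ≠ q - 1 := by
      intro hkq
      refine T.ne_root_of_mem_children hk ?_
      rw [hroot (by omega)]
      exact congrArg c (Fin.ext hkq)
    have := k.isLt
    exact Fin.lt_def.mpr (by omega)

end IsHuffmanSeq

/-- in a directed Huffman tree, leaves of earlier stars have subordinate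
groups of smaller (or equal) weight: `v ∈ L(S_i)`, `v' ∈ L(S_j)`, `i < j` imply
`f_H(v) ≤ f_H(v')`. -/
theorem huffman_star_leaves_monotone {V : Type} [Fintype V] [DecidableEq V]
    (μ : V → ℝ) (d : V → ℕ) (hgen : IsGenTuple μ d) (hmono : DegMonotone μ d)
    (H : DirTree V) (q : ℕ) (c : Fin q → V) (hseq : IsHuffmanSeq μ d H c)
    (i j : Fin q) (hij : i < j) (v v' : V)
    (hv : v ∈ H.children (c i)) (hv' : v' ∈ H.children (c j)) :
    H.f μ v ≤ H.f μ v' := by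
  obtain ⟨hdeg, hinj, hint, -, hstar⟩ := id hseq
  induction j using WellFoundedLT.induction generalizing v' with
  | ind j ih =>
  have hiq : (i : ℕ) < q - 1 := by omega
  obtain ⟨-, -, -, -, -, hone, -, -, hmin⟩ := hstar i hiq
  have pendent_case (hd : stateD d c i v' = 1) : H.f μ v ≤ H.f μ v' := by
    rw [← hseq.stateMu_eq_f (H.ne_root_of_mem_children hv) (hone v hv),
      ← hseq.stateMu_eq_f (H.ne_root_of_mem_children hv') hd]
    refine hmin v hv v' (mem_stateV_of_mem_children hinj hij.le hv') hd fun hvi => ?_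
    exact hij.ne (hinj ((H.parent_eq_of_mem_children hvi).symm.trans
      (H.parent_eq_of_mem_children hv')))
  by_cases hd : 1 < d v'
  · obtain ⟨k, rfl⟩ := (hint v').mp hd
    have hkj : k < j := hseq.lt_of_mem_children hv'
    rcases lt_trichotomy k i with hki | rfl | hik
    · exact pendent_case (if_pos (mem_usedCenters.mpr ⟨k, hki, rfl⟩))
    · exact H.f_le_of_desc hgen.nonneg (H.desc_of_mem_children hv)
    · obtain ⟨x, hx⟩ := H.children_nonempty_of_one_lt_deg ((hdeg _).symm ▸ hd)
      exact (ih k hkj hik x hx).trans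
        (H.f_le_of_desc hgen.nonneg (H.desc_of_mem_children hx))
  · refine pendent_case ?_
    have := hgen.deg_pos v'
    unfold stateD
    split_ifs <;> omega
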